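/- Let C₀, Λ, m > 0, θ ∈ (0, 2) and R ≥ 1 be real numbers. Then there exists a constant C′ > 0, depending only on C₀, Λ, m, θ, R, with the following property: for every measurable function f : ℝ² → [0, ∞) satisfying f(y) ≤ C₀(1 + |y|)^{θ−4} for all y ∈ ℝ², (1/2π)∫_{ℝ²} f ≤ Λ, and (1/2π)∫_{B_R(0)} f ≥ m, and for every z ∈ ℝ² with |z| ≥ 2R, one has (1/2π)∫_{ℝ²} ln(|y|/|y − z|) · f(y) dy ≤ −m·ln|z| + C′. -/

import Mathlib

open MeasureTheory Metric

/-- An integrable function of `w = y - z` which, up to a constant, dominates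
`log (‖y‖ / ‖w‖) * (1 + ‖y‖) ^ (θ - 4)` on the region `‖w‖ ≤ ‖y‖`. -/
noncomputable def singularMajorant (θ : ℝ) (w : EuclideanSpace ℝ (Fin 2)) : ℝ :=
  (ball (0 : EuclideanSpace ℝ (Fin 2)) 1).indicator (fun x => ‖x‖⁻¹) w + (1 + ‖w‖) ^ (θ - 4)

lemma integrable_indicator_norm_inv :
    Integrable ((ball (0 : EuclideanSpace ℝ (Fin 2)) 1).indicator fun x => ‖x‖⁻¹) := by
  rw [integrable_indicator_iff measurableSet_ball]
  refine (integrableOn_fun_norm_addHaar volume (f := fun t : ℝ => t⁻¹)).2 ?_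
  refine (integrableOn_const (C := (1 : ℝ)) (by simp)).congr_fun (fun t ht => ?_) measurableSet_Ioo
  simp [ht.1.ne']

lemma integrable_one_add_norm_rpow {θ : ℝ} (hθ2 : θ < 2) :
    Integrable fun w : EuclideanSpace ℝ (Fin 2) => (1 + ‖w‖) ^ (θ - 4) := by
  have := integrable_one_add_norm (E := EuclideanSpace ℝ (Fin 2)) (μ := volume) (r := 4 - θ)
    (by simp; linarith)
  simpa using this

lemma integrable_singularMajorant {θ : ℝ} (hθ2 : θ < 2) : Integrable (singularMajorant θ) :=
  integrable_indicator_norm_inv.add (integrable_one_add_norm_rpow hθ2)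

lemma singularMajorant_nonneg (θ : ℝ) (w : EuclideanSpace ℝ (Fin 2)) :
    0 ≤ singularMajorant θ w :=
  add_nonneg (Set.indicator_nonneg (fun _ _ => by positivity) _) (by positivity)

/-- A bounded integrable function stays integrable after division by the distance to a point. -/
lemma integrable_inv_norm_sub_mul {f : EuclideanSpace ℝ (Fin 2) → ℝ} {C : ℝ}
    (hf : Integrable f) (hf0 : ∀ y, 0 ≤ f y) (hfC : ∀ y, f y ≤ C)
    (z : EuclideanSpace ℝ (Fin 2)) : Integrable fun y => ‖y - z‖⁻¹ * f y := by
  refine (((integrable_indicator_norm_inv.comp_sub_right z).const_mul C).add hf).mono'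
    (.mul (by fun_prop) hf.1) (.of_forall fun y => ?_)
  rw [Real.norm_of_nonneg (mul_nonneg (by positivity) (hf0 y))]
  simp only [Pi.add_apply]
  by_cases h : y - z ∈ ball (0 : EuclideanSpace ℝ (Fin 2)) 1
  · rw [Set.indicator_of_mem h, mul_comm]
    have := mul_le_mul_of_nonneg_right (hfC y) (inv_nonneg.2 (norm_nonneg (y - z)))
    linarith [hf0 y]
  · rw [Set.indicator_of_notMem h]
    have h1 : 1 ≤ ‖y - z‖ := by simpa using h
    have := mul_le_mul_of_nonneg_right (inv_le_one_of_one_le₀ h1) (hf0 y)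
    linarith

lemma abs_log_norm_div_le {E : Type*} [NormedAddCommGroup E] (y z : E) :
    |Real.log (‖y‖ / ‖y - z‖)| ≤ 1 + ‖z‖ * ‖y - z‖⁻¹ + ‖z‖ * ‖y‖⁻¹ := by
  rcases (norm_nonneg y).eq_or_lt with hy | hy
  · rw [← hy]; simp; positivity
  rcases (norm_nonneg (y - z)).eq_or_lt with hw | hw
  · rw [← hw]; simp; positivity
  have h1 : ‖y‖ ≤ ‖y - z‖ + ‖z‖ := by simpa using norm_add_le (y - z) z
  have h2 : ‖y - z‖ ≤ ‖y‖ + ‖z‖ := norm_sub_le y z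
  have ha : ‖y‖ / ‖y - z‖ ≤ 1 + ‖z‖ * ‖y - z‖⁻¹ := by
    rw [div_le_iff₀ hw]; field_simp; exact h1
  have hb : ‖y - z‖ / ‖y‖ ≤ 1 + ‖z‖ * ‖y‖⁻¹ := by
    rw [div_le_iff₀ hy]; field_simp; exact h2
  have hp : 0 ≤ ‖z‖ * ‖y - z‖⁻¹ := by positivity
  have hq : 0 ≤ ‖z‖ * ‖y‖⁻¹ := by positivity
  rw [abs_le]
  constructor
  · have h3 : Real.log (‖y - z‖ / ‖y‖) = -Real.log (‖y‖ / ‖y - z‖) := by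
      rw [← Real.log_inv, inv_div]
    linarith [Real.log_le_self (x := ‖y - z‖ / ‖y‖) (by positivity)]
  · linarith [Real.log_le_self (x := ‖y‖ / ‖y - z‖) (by positivity)]

lemma integrable_log_norm_div_mul {f : EuclideanSpace ℝ (Fin 2) → ℝ} {C : ℝ}
    (hf : Integrable f) (hf0 : ∀ y, 0 ≤ f y) (hfC : ∀ y, f y ≤ C)
    (z : EuclideanSpace ℝ (Fin 2)) :
    Integrable fun y => Real.log (‖y‖ / ‖y - z‖) * f y := by
  have hz := (integrable_inv_norm_sub_mul hf hf0 hfC z).const_mul ‖z‖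
  have h0 := (integrable_inv_norm_sub_mul hf hf0 hfC 0).const_mul ‖z‖
  refine ((hf.add hz).add h0).mono'
    (.mul (Measurable.aestronglyMeasurable (by fun_prop)) hf.1) (.of_forall fun y => ?_)
  rw [norm_mul, Real.norm_of_nonneg (hf0 y), Real.norm_eq_abs]
  refine (mul_le_mul_of_nonneg_right (abs_log_norm_div_le y z) (hf0 y)).trans_eq ?_
  simp only [Pi.add_apply, sub_zero]
  ring

lemma log_norm_div_mul_le_singularMajorant {C θ a : ℝ} (hC : 0 ≤ C) (hθ : θ ≤ 3)
    {y z : EuclideanSpace ℝ (Fin 2)} (ha0 : 0 ≤ a) (ha : a ≤ C * (1 + ‖y‖) ^ (θ - 4))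
    (hyz : ‖y - z‖ ≤ ‖y‖) :
    Real.log (‖y‖ / ‖y - z‖) * a ≤ 2 * C * singularMajorant θ (y - z) := by
  have hG := singularMajorant_nonneg θ (y - z)
  rcases (norm_nonneg (y - z)).eq_or_lt with hw | hw
  · rw [← hw]; simp; positivity
  have hsplit : ∀ t : ℝ, 0 ≤ t → (1 + t) ^ (θ - 3) = (1 + t) * (1 + t) ^ (θ - 4) := by
    intro t ht
    rw [show θ - 3 = 1 + (θ - 4) by ring, Real.rpow_add (by positivity), Real.rpow_one]
  have hya : ‖y‖ * a ≤ C * (1 + ‖y‖) ^ (θ - 3) := by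
    rw [hsplit _ (norm_nonneg y)]
    have hp : 0 ≤ C * (1 + ‖y‖) ^ (θ - 4) := by positivity
    nlinarith [norm_nonneg y]
  have hlog : Real.log (‖y‖ / ‖y - z‖) * a ≤ C * (1 + ‖y‖) ^ (θ - 3) * ‖y - z‖⁻¹ := by
    calc Real.log (‖y‖ / ‖y - z‖) * a ≤ ‖y‖ / ‖y - z‖ * a :=
          mul_le_mul_of_nonneg_right (Real.log_le_self (by positivity)) ha0
      _ = ‖y‖ * a * ‖y - z‖⁻¹ := by ring
      _ ≤ _ := mul_le_mul_of_nonneg_right hya (by positivity)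
  refine hlog.trans ?_
  have hq : 0 ≤ (1 + ‖y - z‖) ^ (θ - 4) := by positivity
  unfold singularMajorant
  by_cases h : y - z ∈ ball (0 : EuclideanSpace ℝ (Fin 2)) 1
  · rw [Set.indicator_of_mem h]
    have h1 : (1 + ‖y‖) ^ (θ - 3) ≤ 1 :=
      Real.rpow_le_one_of_one_le_of_nonpos (by linarith [norm_nonneg y]) (by linarith)
    have h2 : C * (1 + ‖y‖) ^ (θ - 3) * ‖y - z‖⁻¹ ≤ C * 1 * ‖y - z‖⁻¹ := by gcongr
    have h3 : 0 ≤ C * ‖y - z‖⁻¹ := by positivity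
    nlinarith [mul_nonneg hC hq]
  · rw [Set.indicator_of_notMem h, zero_add]
    have h1 : 1 ≤ ‖y - z‖ := by simpa using h
    have h2 : (1 + ‖y‖) ^ (θ - 3) ≤ (1 + ‖y - z‖) ^ (θ - 3) :=
      Real.rpow_le_rpow_of_nonpos (by positivity) (by linarith) (by linarith)
    have h3 : (1 + ‖y - z‖) * ‖y - z‖⁻¹ ≤ 2 := by
      rw [← div_eq_mul_inv, div_le_iff₀ hw]; linarith
    calc C * (1 + ‖y‖) ^ (θ - 3) * ‖y - z‖⁻¹
        ≤ C * (1 + ‖y - z‖) ^ (θ - 3) * ‖y - z‖⁻¹ := by gcongr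
      _ = C * (1 + ‖y - z‖) ^ (θ - 4) * ((1 + ‖y - z‖) * ‖y - z‖⁻¹) := by
          rw [hsplit _ hw.le]; ring
      _ ≤ C * (1 + ‖y - z‖) ^ (θ - 4) * 2 := by gcongr
      _ = _ := by ring

lemma log_norm_div_mul_le {C θ R : ℝ} (hC : 0 ≤ C) (hθ : θ ≤ 3) (hR : 1 ≤ R)
    {f : EuclideanSpace ℝ (Fin 2) → ℝ} (hf0 : ∀ y, 0 ≤ f y)
    (hf : ∀ y, f y ≤ C * (1 + ‖y‖) ^ (θ - 4)) {y z : EuclideanSpace ℝ (Fin 2)}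
    (hz : 2 * R ≤ ‖z‖) (hy : y ≠ 0) :
    Real.log (‖y‖ / ‖y - z‖) * f y ≤
      (Real.log (2 * R) - Real.log ‖z‖) *
          (ball (0 : EuclideanSpace ℝ (Fin 2)) R).indicator f y +
        Real.log 3 * f y + 2 * C * singularMajorant θ (y - z) := by
  have hG : 0 ≤ 2 * C * singularMajorant θ (y - z) :=
    mul_nonneg (by positivity) (singularMajorant_nonneg θ (y - z))
  have h3 : 0 ≤ Real.log 3 * f y := mul_nonneg (Real.log_nonneg (by norm_num)) (hf0 y)
  have hy0 : 0 < ‖y‖ := norm_pos_iff.2 hy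
  have hyw : ‖y‖ ≤ ‖y - z‖ + ‖z‖ := by simpa using norm_add_le (y - z) z
  have hzw : ‖z‖ ≤ ‖y‖ + ‖y - z‖ := by simpa using norm_sub_le y (y - z)
  by_cases h : y ∈ ball (0 : EuclideanSpace ℝ (Fin 2)) R
  · rw [Set.indicator_of_mem h]
    have h1 : ‖y‖ < R := by simpa using h
    have hlog : Real.log (‖y‖ / ‖y - z‖) ≤ Real.log (2 * R) - Real.log ‖z‖ := by
      rw [← Real.log_div (by positivity) (by linarith)]
      have hw : 0 < ‖y - z‖ := by linarith
      refine Real.log_le_log (by positivity) ?_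
      rw [div_le_div_iff₀ hw (by linarith)]
      nlinarith
    have := mul_le_mul_of_nonneg_right hlog (hf0 y)
    linarith
  · rw [Set.indicator_of_notMem h, mul_zero, zero_add]
    by_cases hn : ‖y - z‖ ≤ ‖z‖ / 2
    · have := log_norm_div_mul_le_singularMajorant hC hθ (hf0 y) (hf y) (z := z) (by linarith)
      linarith
    · have hw : 0 < ‖y - z‖ := by linarith
      have hlog : Real.log (‖y‖ / ‖y - z‖) ≤ Real.log 3 := by
        refine Real.log_le_log (by positivity) ?_
        rw [div_le_iff₀ hw]
        linarith
      have := mul_le_mul_of_nonneg_right hlog (hf0 y)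
      linarith

/-- Logarithmic-potential upper bound: for constants `C₀, Λ, m > 0`,
`θ ∈ (0,2)`, `R ≥ 1`, there is `C′ > 0` such that for every nonnegative
measurable `f` on `ℝ²` with `f(y) ≤ C₀(1+|y|)^{θ−4}`, total mass
`(1/2π)∫ f ≤ Λ` and mass at least `m` on `B_R(0)`, and every `z` with
`|z| ≥ 2R`, one has `(1/2π)∫ ln(|y|/|y−z|) f(y) dy ≤ −m ln|z| + C′`. -/
theorem log_potential_upper_bound
    (C₀ Λ m θ R : ℝ) (hC₀ : 0 < C₀) (hΛ : 0 < Λ) (hm : 0 < m)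
    (hθ0 : 0 < θ) (hθ2 : θ < 2) (hR : 1 ≤ R) :
    ∃ C' : ℝ, 0 < C' ∧
      ∀ f : EuclideanSpace ℝ (Fin 2) → ℝ, Measurable f →
        (∀ y, 0 ≤ f y) →
        (∀ y, f y ≤ C₀ * (1 + ‖y‖) ^ (θ - 4)) →
        (1 / (2 * Real.pi)) * (∫ y, f y) ≤ Λ →
        m ≤ (1 / (2 * Real.pi)) *
              ∫ y in ball (0 : EuclideanSpace ℝ (Fin 2)) R, f y →
        ∀ z : EuclideanSpace ℝ (Fin 2), 2 * R ≤ ‖z‖ →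
          (1 / (2 * Real.pi)) * (∫ y, Real.log (‖y‖ / ‖y - z‖) * f y)
            ≤ -m * Real.log ‖z‖ + C' := by
  have hG0 : 0 ≤ ∫ w, singularMajorant θ w := integral_nonneg (singularMajorant_nonneg θ)
  have hlogR : 0 < Real.log (2 * R) := Real.log_pos (by linarith)
  have hlog3 : 0 < Real.log 3 := Real.log_pos (by norm_num)
  refine ⟨m * Real.log (2 * R) + Real.log 3 * Λ +
    1 / (2 * Real.pi) * (2 * C₀ * ∫ w, singularMajorant θ w), by positivity, ?_⟩
  intro f hfm hf0 hf hfΛ hfR z hz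
  have hfC : ∀ y, f y ≤ C₀ := fun y => (hf y).trans <| mul_le_of_le_one_right hC₀.le <|
    Real.rpow_le_one_of_one_le_of_nonpos (by linarith [norm_nonneg y]) (by linarith)
  have hfi : Integrable f :=
    ((integrable_one_add_norm_rpow hθ2).const_mul C₀).mono' hfm.aestronglyMeasurable
      (.of_forall fun y => by rw [Real.norm_of_nonneg (hf0 y)]; exact hf y)
  have hi1 : Integrable fun y => (Real.log (2 * R) - Real.log ‖z‖) *
      (ball (0 : EuclideanSpace ℝ (Fin 2)) R).indicator f y :=
    (hfi.indicator measurableSet_ball).const_mul _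
  have hi2 : Integrable fun y => Real.log 3 * f y := hfi.const_mul _
  have hi3 : Integrable fun y => 2 * C₀ * singularMajorant θ (y - z) :=
    ((integrable_singularMajorant hθ2).comp_sub_right z).const_mul _
  have hae : ∀ᵐ y : EuclideanSpace ℝ (Fin 2), y ≠ 0 := by
    simp [ae_iff, measure_singleton]
  have key := integral_mono_ae (integrable_log_norm_div_mul hfi hf0 hfC z)
    ((hi1.add hi2).add hi3)
    (hae.mono fun y hy => log_norm_div_mul_le hC₀.le (by linarith) hR hf0 hf hz hy)
  rw [integral_add' (hi1.add hi2) hi3, integral_add' hi1 hi2, integral_const_mul,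
    integral_const_mul, integral_const_mul, integral_indicator measurableSet_ball,
    integral_sub_right_eq_self (singularMajorant θ) z] at key
  have hzR : Real.log (2 * R) ≤ Real.log ‖z‖ := Real.log_le_log (by linarith) hz
  have hpi : 0 ≤ 1 / (2 * Real.pi) := by positivity
  have key' := mul_le_mul_of_nonneg_left key hpi
  have e1 := mul_le_mul_of_nonneg_left hfR (sub_nonneg.2 hzR)
  have e2 := mul_le_mul_of_nonneg_left hfΛ hlog3.le
  linarith
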